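/- Let (X,d) be a complete metric space with at least 3 points, and let T : X → X be continuous and asymptotically regular. Suppose there exist α ∈ [0, 1/2) and functions β₁, β₂, β₃ : [0,∞) → [0,∞) each satisfying limsup_{t→0⁺} βᵢ(t) < ∞, such that for all pairwise distinct x, y, z ∈ X: d(Tx,Ty) + d(Ty,Tz) + d(Tx,Tz) ≤ α(d(x,y) + d(y,z) + d(x,z)) + β₁(d(x,Tx))·d(x,Tx) + β₂(d(y,Ty))·d(y,Ty) + β₃(d(z,Tz))·d(z,Tz). Then T has a fixed point, and the number of fixed points of T is at most two. -/

import Mathlib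

open Filter Topology NNReal

/-- A periodic point of an asymptotically regular map is a fixed point. -/
lemma isFixedPt_of_isPeriodicPt_of_tendsto_dist {X : Type*} [MetricSpace X] {T : X → X} {y : X}
    {p : ℕ} (hp : 0 < p) (hy : Function.IsPeriodicPt T p y)
    (har : Tendsto (fun n : ℕ => dist (T^[n + 1] y) (T^[n] y)) atTop (𝓝 0)) : T y = y := by
  have hmul : Tendsto (fun k : ℕ => k * p) atTop atTop := tendsto_id.atTop_mul_const' hp
  have hconst : ∀ k : ℕ, dist (T^[k * p + 1] y) (T^[k * p] y) = dist (T y) y := fun k => by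
    have hk : T^[k * p] y = y := hy.const_mul k
    rw [Function.iterate_succ_apply', hk]
  have hlim := har.comp hmul
  simp only [Function.comp_def, hconst] at hlim
  exact dist_eq_zero.mp (tendsto_nhds_unique tendsto_const_nhds hlim)

/-- If the displacements `dist (u n) (T (u n))` tend to `0` and `β` is bounded near `0`,
then `β` is eventually bounded along the displacements. -/
lemma exists_eventually_coe_le_of_isBoundedUnder {X : Type*} [MetricSpace X] {T : X → X}
    {u : ℕ → X} {β : ℝ≥0 → ℝ≥0} (hβ : IsBoundedUnder (· ≤ ·) (𝓝 (0 : ℝ≥0)) β)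
    (hu : Tendsto (fun n => dist (u n) (T (u n))) atTop (𝓝 0)) :
    ∃ M : ℝ≥0, ∀ᶠ n in atTop, (β (nndist (u n) (T (u n))) : ℝ) ≤ M := by
  obtain ⟨M, hM⟩ := hβ
  have hu' : Tendsto (fun n => nndist (u n) (T (u n))) atTop (𝓝 0) := by
    rw [← NNReal.tendsto_coe]
    simpa using hu
  exact ⟨M, (hu'.eventually (eventually_map.mp hM)).mono fun n hn => NNReal.coe_le_coe.mpr hn⟩

/-- A continuous, asymptotically regular generalized 𝓑-Ćirić–Reich–Rus type
mapping on a complete metric space with at least 3 points has a fixed point,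
and at most two fixed points.  Here βᵢ : [0,∞) → [0,∞) satisfy
limsup_{t→0} βᵢ(t) < ∞, formalized as βᵢ being eventually bounded above near 0. -/
theorem generalized_B_crr_fixed_point
    {X : Type*} [MetricSpace X] [CompleteSpace X]
    (h3 : ∃ p q r : X, p ≠ q ∧ p ≠ r ∧ q ≠ r)
    (T : X → X) (hcont : Continuous T)
    (har : ∀ x : X,
      Tendsto (fun n : ℕ => dist (T^[n + 1] x) (T^[n] x)) atTop (𝓝 0))
    (α : ℝ) (hα0 : 0 ≤ α) (hα1 : α < 1 / 2)
    (β₁ β₂ β₃ : ℝ≥0 → ℝ≥0)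
    (hβ₁ : IsBoundedUnder (· ≤ ·) (𝓝 (0 : ℝ≥0)) β₁)
    (hβ₂ : IsBoundedUnder (· ≤ ·) (𝓝 (0 : ℝ≥0)) β₂)
    (hβ₃ : IsBoundedUnder (· ≤ ·) (𝓝 (0 : ℝ≥0)) β₃)
    (hT : ∀ x y z : X, x ≠ y → y ≠ z → x ≠ z →
      dist (T x) (T y) + dist (T y) (T z) + dist (T x) (T z) ≤
        α * (dist x y + dist y z + dist x z) +
        (β₁ (nndist x (T x)) : ℝ) * dist x (T x) +
        (β₂ (nndist y (T y)) : ℝ) * dist y (T y) +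
        (β₃ (nndist z (T z)) : ℝ) * dist z (T z)) :
    (∃ x : X, T x = x) ∧
    (∀ x y z : X, T x = x → T y = y → T z = z → x = y ∨ y = z ∨ x = z) := by
  refine ⟨?_, fun x y z hx hy hz => ?_⟩
  · by_contra! hfix
    obtain ⟨a, -⟩ := h3
    set u : ℕ → X := fun n => T^[n] a
    have hTu : ∀ n, T (u n) = u (n + 1) := fun n => (Function.iterate_succ_apply' T n a).symm
    have hc : Tendsto (fun n => dist (u n) (T (u n))) atTop (𝓝 0) := by
      refine (har a).congr fun n => ?_
      rw [hTu, dist_comm]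
    have hne : ∀ n m, n < m → u n ≠ u m := fun n m hnm h => by
      refine hfix (u n) (isFixedPt_of_isPeriodicPt_of_tendsto_dist (Nat.sub_pos_of_lt hnm) ?_
        (har (u n)))
      change T^[m - n] (T^[n] a) = u n
      rw [← Function.iterate_add_apply, Nat.sub_add_cancel hnm.le]
      exact h.symm
    obtain ⟨M₁, hM₁⟩ := exists_eventually_coe_le_of_isBoundedUnder hβ₁ hc
    obtain ⟨M₂, hM₂⟩ := exists_eventually_coe_le_of_isBoundedUnder hβ₂ hc
    obtain ⟨M₃, hM₃⟩ := exists_eventually_coe_le_of_isBoundedUnder hβ₃ hc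
    have hcauchy : CauchySeq u := by
      rw [Metric.cauchySeq_iff']
      intro ε hε
      set K : ℝ := 5 + M₁ + M₂ + M₃ with hK
      have hKpos : 0 < K := by positivity
      obtain ⟨N, hN⟩ := eventually_atTop.mp
        (((hM₁.and hM₂).and hM₃).and (hc.eventually (gt_mem_nhds (div_pos hε hKpos))))
      refine ⟨N, fun m hm => ?_⟩
      rcases hm.eq_or_lt with rfl | hlt
      · simpa using hε
      obtain ⟨⟨⟨b₁, -⟩, -⟩, c₁⟩ := hN N le_rfl
      obtain ⟨⟨⟨-, b₂⟩, -⟩, c₂⟩ := hN m hm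
      obtain ⟨⟨-, b₃⟩, c₃⟩ := hN (m + 1) (by omega)
      have key := hT (u N) (u m) (u (m + 1)) (hne _ _ hlt) (hne _ _ (by omega))
        (hne _ _ (by omega))
      set δ : ℝ := ε / K
      have hKδ : K * δ = ε := mul_div_cancel₀ ε hKpos.ne'
      have p₁ := mul_le_mul b₁ c₁.le dist_nonneg M₁.coe_nonneg
      have p₂ := mul_le_mul b₂ c₂.le dist_nonneg M₂.coe_nonneg
      have p₃ := mul_le_mul b₃ c₃.le dist_nonneg M₃.coe_nonneg
      have t₁ := dist_triangle4 (u N) (T (u N)) (T (u m)) (u m)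
      have t₂ := dist_triangle (T (u N)) (T (u (m + 1))) (T (u m))
      have t₃ := dist_triangle (u N) (u m) (u (m + 1))
      rw [dist_comm (T (u m)) (u m)] at t₁
      rw [dist_comm (T (u (m + 1))) (T (u m))] at t₂
      have hmm : dist (u m) (u (m + 1)) < δ := by rw [← hTu m]; exact c₂
      have hα : α * (dist (u N) (u m) + dist (u m) (u (m + 1)) + dist (u N) (u (m + 1))) ≤
          1 / 2 * (2 * dist (u N) (u m) + 2 * δ) :=
        mul_le_mul hα1.le (by linarith) (by positivity) (by norm_num)
      rw [dist_comm, ← hKδ, hK]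
      linarith
    obtain ⟨l, hl⟩ := cauchySeq_tendsto_of_complete hcauchy
    exact hfix l (isFixedPt_of_tendsto_iterate hl hcont.continuousAt)
  · by_contra! h
    have key := hT x y z h.1 h.2.1 h.2.2
    simp only [hx, hy, hz, dist_self, mul_zero, add_zero] at key
    nlinarith [dist_pos.mpr h.1, dist_pos.mpr h.2.1, dist_pos.mpr h.2.2]
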